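/- Let α be a cascading n-sequence and RC(α) = (ν₁, ..., ν_n). Fix l in {1, ..., n} and a string of ν_l of length s. Then the rigging of this string equals minus the number of column indices i <= s that are capped for the l-th partition, plus the number of column indices i <= s that are capped for the (l-1)-st partition, where for l = 1 the second count is taken to be 0. -/

import Mathlib

namespace CascRC

abbrev RP := Multiset (ℕ × ℤ)
abbrev RC := ℕ → RP

/-- The Cartan matrix of type `A`. -/
def cartanA (a b : ℕ) : ℤ :=
  if a = b then 2 else if b = a + 1 ∨ a = b + 1 then -1 else 0

/-- The smallest rigging of a rigged partition (0 if empty). -/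
noncomputable def minRig (ν : RP) : ℤ :=
  if h : ν = 0 then 0
  else (ν.map Prod.snd).toFinset.min'
    (Multiset.toFinset_nonempty.mpr (by simpa [Multiset.map_eq_zero] using h))

/-- The greatest length of a string whose rigging is the smallest rigging. -/
noncomputable def selLen (ν : RP) : ℕ :=
  ((ν.filter (fun s => s.2 = minRig ν)).map Prod.fst).sup

/-- The Kashiwara operator `f_a` on rigged configurations. -/
noncomputable def fOp (a : ℕ) (R : RC) : RC :=
  if R a = 0 ∨ 0 < minRig (R a) then
    fun b => (if b = a then ({(1, -1)} : RP) else 0)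
      + (R b).map (fun s => if 0 < s.1 then (s.1, s.2 - cartanA a b) else s)
  else
    fun b =>
      (if b = a then ({(selLen (R a) + 1, minRig (R a) - 1)} : RP) else 0)
      + ((if b = a then (R a).erase (selLen (R a), minRig (R a)) else R b).map
          (fun s => if selLen (R a) < s.1 then (s.1, s.2 - cartanA a b) else s))

/-- A list `γ` acts by `f_γ = f_{γ_p} ∘ ⋯ ∘ f_{γ₁}`. -/
noncomputable def fList (γ : List ℕ) (R : RC) : RC :=
  γ.foldl (fun S a => fOp a S) R

def emptyRC : RC := fun _ => 0

/-- `RC(α)`: the result of the list `α` acting on the empty rigged configuration. -/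
noncomputable def RCseq (α : List ℕ) : RC := fList α emptyRC

/-- The `m`-lower subinterval `(a, a+1, …, m)`. -/
def lowerInt (a m : ℕ) : List ℕ := List.range' a (m + 1 - a)

def IsLowerIv (n : ℕ) (p : ℕ × ℕ) : Prop := 1 ≤ p.1 ∧ p.1 ≤ p.2 ∧ p.2 ≤ n

/-- Ordering between consecutive lower subintervals in a cascading sequence. -/
def CascCh (p q : ℕ × ℕ) : Prop := q.2 < p.2 ∨ (q.2 = p.2 ∧ p.1 ≤ q.1)

/-- `ivs` is the lower-subinterval decomposition of a cascading `n`-sequence. -/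
def IsCascDecomp (n : ℕ) (ivs : List (ℕ × ℕ)) : Prop :=
  (∀ p ∈ ivs, IsLowerIv n p) ∧ ivs.Chain' CascCh

/-- The integer sequence determined by a decomposition into lower subintervals. -/
def seqOf (ivs : List (ℕ × ℕ)) : List ℕ :=
  (ivs.map (fun p => lowerInt p.1 p.2)).flatten

/-- `R_k`: the rigged configuration corresponding to `I_1 ⋯ I_k`. -/
noncomputable def Rk (ivs : List (ℕ × ℕ)) (k : ℕ) : RC :=
  RCseq (seqOf (ivs.take k))

/-- Height of column `c` of (the underlying partition of) a rigged partition. -/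
def colHt (ν : RP) (c : ℕ) : ℕ := (ν.filter (fun s => c ≤ s.1)).card

/-- Length of the `i`-th row (1-based) of the underlying partition. -/
def rowLen (ν : RP) (i : ℕ) : ℕ :=
  ((Finset.Icc 1 ((ν.map Prod.fst).sup)).filter (fun c => i ≤ colHt ν c)).card

/-- Length of the uppermost row of length at most `L` (0 for the virtual empty row). -/
def upRowLen (ν : RP) (L : ℕ) : ℕ := rowLen ν (colHt ν (L + 1) + 1)

/-- The column to which an application of `f_a` adds a box. -/
noncomputable def selCol (a : ℕ) (R : RC) : ℕ :=
  if R a = 0 ∨ 0 < minRig (R a) then 1 else selLen (R a) + 1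

/-- Given a lower subinterval `p = (a, m)` acting on `R`, the column to which the
operator `f_l` occurring in it adds a box in the `l`-th partition. -/
noncomputable def ivCol (p : ℕ × ℕ) (l : ℕ) (R : RC) : ℕ :=
  selCol l (fList (lowerInt p.1 (l - 1)) R)

/-- Lengths `|r_a|, |r_{a+1}|, …` of the rows `r_i` of Lemma "snake":
`rLenSeq R a (i - a) = |r_i|`. -/
def rLenSeq (R : RC) (a : ℕ) : ℕ → ℕ
  | 0 => rowLen (R a) 1
  | k + 1 => upRowLen (R (a + k + 1)) (rLenSeq R a k)


/-- Column index `i` is capped for the `l`-th partition: some lower subinterval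
`I_{k+1}` with maximum `l` adds, via its final operator `f_l`, a box to column `i`
of the `l`-th partition. -/
def Capped (ivs : List (ℕ × ℕ)) (l i : ℕ) : Prop :=
  ∃ k, ∃ h : k < ivs.length, (ivs[k]'h).2 = l ∧ ivCol (ivs[k]'h) l (Rk ivs k) = i

/-- `f_a` lengthens the string `(L, x)` of `ν`, or creates a new string, seen as
the virtual string `(0, 0)`. -/
def Selects (ν : RP) (L : ℕ) (x : ℤ) : Prop :=
  ((L, x) ∈ ν ∧ x ≤ 0 ∧ ∀ s y, (s, y) ∈ ν → x ≤ y ∧ (y = x → s ≤ L)) ∨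
    (L = 0 ∧ x = 0 ∧ ∀ s y, (s, y) ∈ ν → 0 < y)

lemma minRig_le {ν : RP} {s : ℕ} {y : ℤ} (h : (s, y) ∈ ν) : minRig ν ≤ y := by
  have h0 : ν ≠ 0 := by
    rintro rfl
    simp at h
  rw [minRig, dif_neg h0]
  exact Finset.min'_le _ _ (by simpa using ⟨s, h⟩)

lemma exists_mem_minRig {ν : RP} (h0 : ν ≠ 0) : ∃ s, (s, minRig ν) ∈ ν := by
  rw [minRig, dif_neg h0]
  have h := Finset.min'_mem (ν.map Prod.snd).toFinset
    (Multiset.toFinset_nonempty.mpr (by simpa [Multiset.map_eq_zero] using h0))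
  simpa using h

lemma minRig_eq {ν : RP} {L : ℕ} {x : ℤ} (h : (L, x) ∈ ν)
    (hle : ∀ s y, (s, y) ∈ ν → x ≤ y) : minRig ν = x := by
  have h0 : ν ≠ 0 := by
    rintro rfl
    simp at h
  obtain ⟨s, hs⟩ := exists_mem_minRig h0
  exact le_antisymm (minRig_le h) (hle _ _ hs)

lemma selLen_eq {ν : RP} {L : ℕ} {x : ℤ} (h : (L, x) ∈ ν)
    (hle : ∀ s y, (s, y) ∈ ν → x ≤ y ∧ (y = x → s ≤ L)) : selLen ν = L := by
  have hm := minRig_eq h fun s y hs => (hle s y hs).1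
  rw [selLen, hm]
  apply le_antisymm
  · rw [Multiset.sup_le]
    intro b hb
    obtain ⟨⟨s, y⟩, hs, rfl⟩ := Multiset.mem_map.1 hb
    rw [Multiset.mem_filter] at hs
    exact (hle s y hs.1).2 hs.2
  · exact Multiset.le_sup (Multiset.mem_map.2 ⟨(L, x), Multiset.mem_filter.2 ⟨h, rfl⟩, rfl⟩)

lemma Selects.selCol_eq {a : ℕ} {R : RC} {L : ℕ} {x : ℤ} (h : Selects (R a) L x) :
    selCol a R = L + 1 := by
  rcases h with ⟨hm, hx, hle⟩ | ⟨rfl, rfl, hpos⟩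
  · have h1 := minRig_eq hm fun s y hs => (hle s y hs).1
    rw [selCol, if_neg, selLen_eq hm hle]
    rintro (h0 | h0)
    · simp [h0] at hm
    · omega
  · rw [selCol, if_pos]
    by_cases h0 : R a = 0
    · exact Or.inl h0
    · obtain ⟨s, hs⟩ := exists_mem_minRig h0
      exact Or.inr (hpos _ _ hs)

lemma Selects.fOp_eq {a : ℕ} {R : RC} {L : ℕ} {x : ℤ} (h : Selects (R a) L x) (b : ℕ) :
    fOp a R b = (if b = a then ({(L + 1, x - 1)} : RP) else 0)
      + ((if b = a then (R a).erase (L, x) else R b).map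
          (fun s => if L < s.1 then (s.1, s.2 - cartanA a b) else s)) := by
  rcases h with ⟨hm, hx, hle⟩ | ⟨rfl, rfl, hpos⟩
  · have h1 := minRig_eq hm fun s y hs => (hle s y hs).1
    rw [fOp, if_neg, selLen_eq hm hle, h1]
    rintro (h0 | h0)
    · simp [h0] at hm
    · omega
  · have hc : R a = 0 ∨ 0 < minRig (R a) := by
      by_cases h0 : R a = 0
      · exact Or.inl h0
      · obtain ⟨s, hs⟩ := exists_mem_minRig h0
        exact Or.inr (hpos _ _ hs)
    have he : (R a).erase (0, 0) = R a :=
      Multiset.erase_of_notMem fun h0 => lt_irrefl _ (hpos _ _ h0)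
    rw [fOp, if_pos hc, he]
    by_cases hb : b = a
    · subst hb
      simp
    · simp [hb]

/-- Every string of `f_a R` is either the lengthened string or an old string with its
rigging adjusted. -/
lemma Selects.of_mem_fOp {a : ℕ} {R : RC} {L : ℕ} {x : ℤ} (h : Selects (R a) L x)
    {b s : ℕ} {y : ℤ} (hs : (s, y) ∈ fOp a R b) :
    (b = a ∧ s = L + 1 ∧ y = x - 1) ∨
      ∃ z, (s, z) ∈ R b ∧ y = z - if L < s then cartanA a b else 0 := by
  rw [h.fOp_eq, Multiset.mem_add] at hs
  rcases hs with hs | hs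
  · left
    by_cases hb : b = a
    · simpa [hb] using hs
    · simp [hb] at hs
  · right
    obtain ⟨⟨t, z⟩, ht, he⟩ := Multiset.mem_map.1 hs
    have ht' : (t, z) ∈ R b := by
      by_cases hb : b = a
      · subst hb
        rw [if_pos rfl] at ht
        exact Multiset.mem_of_mem_erase ht
      · rwa [if_neg hb] at ht
    by_cases hL : L < t
    · simp only [hL, if_true, Prod.mk.injEq] at he
      obtain ⟨rfl, rfl⟩ := he
      exact ⟨z, ht', by simp [hL]⟩
    · simp only [hL, if_false, Prod.mk.injEq] at he
      obtain ⟨rfl, rfl⟩ := he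
      exact ⟨z, ht', by simp [hL]⟩

lemma Selects.exists_mem_fOp_of_ne {a : ℕ} {R : RC} {L : ℕ} {x : ℤ} (h : Selects (R a) L x)
    {b s : ℕ} (hb : b ≠ a) (hs : ∃ z, (s, z) ∈ R b) : ∃ y, (s, y) ∈ fOp a R b := by
  obtain ⟨z, hz⟩ := hs
  by_cases hL : L < s
  · refine ⟨z - cartanA a b, ?_⟩
    rw [h.fOp_eq, if_neg hb, if_neg hb, zero_add]
    exact Multiset.mem_map.2 ⟨(s, z), hz, by simp [hL]⟩
  · refine ⟨z, ?_⟩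
    rw [h.fOp_eq, if_neg hb, if_neg hb, zero_add]
    exact Multiset.mem_map.2 ⟨(s, z), hz, by simp [hL]⟩

lemma Selects.mem_fOp_self {a : ℕ} {R : RC} {L : ℕ} {x : ℤ} (h : Selects (R a) L x) :
    (L + 1, x - 1) ∈ fOp a R a := by
  rw [h.fOp_eq, if_pos rfl]
  simp

lemma colHt_add (μ ν : RP) (t : ℕ) : colHt (μ + ν) t = colHt μ t + colHt ν t := by
  simp [colHt]

lemma colHt_singleton (s : ℕ) (y : ℤ) (t : ℕ) :
    colHt {(s, y)} t = if t ≤ s then 1 else 0 := by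
  by_cases h : t ≤ s <;> simp [colHt, Multiset.filter_singleton, h]

lemma colHt_map (ν : RP) (f : ℕ × ℤ → ℕ × ℤ) (hf : ∀ s, (f s).1 = s.1) (t : ℕ) :
    colHt (ν.map f) t = colHt ν t := by
  simp [colHt, Multiset.filter_map, hf]

lemma Selects.colHt_fOp {a : ℕ} {R : RC} {L : ℕ} {x : ℤ} (h : Selects (R a) L x)
    (b : ℕ) {t : ℕ} (ht : 1 ≤ t) :
    colHt (fOp a R b) t = colHt (R b) t + if b = a ∧ t = L + 1 then 1 else 0 := by
  rw [h.fOp_eq, colHt_add, colHt_map _ _ (by intro s; split_ifs <;> rfl)]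
  by_cases hb : b = a
  · subst hb
    simp only [if_true, colHt_singleton, true_and]
    rcases h with ⟨hm, -, -⟩ | ⟨rfl, rfl, hpos⟩
    · have hc := Multiset.cons_erase hm
      rw [← Multiset.singleton_add] at hc
      have h2 : colHt (R b) t = (if t ≤ L then 1 else 0) + colHt ((R b).erase (L, x)) t := by
        rw [← colHt_singleton L x, ← colHt_add, hc]
      rw [h2]
      split_ifs <;> omega
    · rw [Multiset.erase_of_notMem fun h0 => lt_irrefl _ (hpos _ _ h0)]
      split_ifs <;> omega
  · simp [hb, colHt]

lemma colHt_anti (ν : RP) {u v : ℕ} (h : u ≤ v) : colHt ν v ≤ colHt ν u :=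
  Multiset.card_le_card (Multiset.monotone_filter_right ν fun _ hs => le_trans h hs)

lemma le_of_colHt_le {ν : RP} {u v : ℕ} (h : u ≤ v) (hc : colHt ν u ≤ colHt ν v)
    {s : ℕ} {y : ℤ} (hs : (s, y) ∈ ν) (hu : u ≤ s) : v ≤ s := by
  have he := Multiset.eq_of_le_of_card_le
    (Multiset.monotone_filter_right ν (p := fun s => v ≤ s.1) (q := fun s => u ≤ s.1)
      fun _ hs => le_trans h hs) hc
  have h2 : (s, y) ∈ ν.filter (fun s => u ≤ s.1) := Multiset.mem_filter.2 ⟨hs, hu⟩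
  rw [← he] at h2
  exact (Multiset.mem_filter.1 h2).2

lemma colHt_le_of_forall {ν : RP} {u v : ℕ}
    (h : ∀ s y, (s, y) ∈ ν → u ≤ s → v ≤ s) : colHt ν u ≤ colHt ν v := by
  unfold colHt
  have he : ν.filter (fun s => u ≤ s.1) = ν.filter (fun s => u ≤ s.1 ∧ v ≤ s.1) :=
    Multiset.filter_congr fun s hs => ⟨fun hu => ⟨hu, h s.1 s.2 hs hu⟩, fun hu => hu.1⟩
  rw [he]
  exact Multiset.card_le_card (Multiset.monotone_filter_right ν fun _ hs => hs.2)

/-- The rigging of a string of length `s` of the `j`-th partition predicted by the sets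
`C` of capped columns. -/
def cappedRig (C : ℕ → Finset ℕ) (j s : ℕ) : ℤ :=
  -(((C j).filter (· ≤ s)).card : ℤ) + (((C (j - 1)).filter (· ≤ s)).card : ℤ)

/-- The state reached while a lower subinterval `(a, …, m)` is being applied: `f_i` comes
next, `f_{i-1}` has just added a box to column `c`, and `e j` is the column of the box
added last to the `j`-th partition within the `m`-component (`0` if there is none). -/
structure Cascade (a m i c : ℕ) (R : RC) (C : ℕ → Finset ℕ) (e : ℕ → ℕ) : Prop where
  zero : R 0 = 0
  pos : ∀ j s x, (s, x) ∈ R j → 1 ≤ s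
  rig : ∀ j s x, (s, x) ∈ R j → x = cappedRig C j s
    + (if j = i ∧ c ≤ s then 1 else 0) - (if j + 1 = i ∧ c ≤ s then 1 else 0)
  capEmpty : ∀ j < m, C j = ∅
  capPos : ∀ j, ∀ t ∈ C j, 1 ≤ t
  le : ∀ j < m, ∀ t, 1 ≤ t →
    colHt (R j) t ≤ colHt (R (j + 1)) t + if j + 1 = i ∧ t = c then 1 else 0
  ge : ∀ j < m, ∀ t, 1 ≤ t →
    (colHt (R (j + 1)) t + if j + 1 = i ∧ t = c then 1 else 0) ≤ colHt (R j) t + 1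
  str : ∀ j, a ≤ j → j ≤ m → e j = 0 ∨ ∃ x, (e j, x) ∈ R j
  anti : ∀ j, a ≤ j → j < m → j + 1 ≠ i → e (j + 1) ≤ e j
  front : ∀ j, a ≤ j → j + 1 = i → e j = c
  next : i ≤ m → e i < c
  capLe : i ≤ m → ∀ t ∈ C m, t ≤ e m
  capLt : m < i → ∀ t ∈ C m, t < c

lemma exists_longest_lt (ν : RP) (c : ℕ) (hc : 1 ≤ c) :
    ∃ L < c, (L = 0 ∨ ∃ x, (L, x) ∈ ν) ∧ ∀ s y, (s, y) ∈ ν → s < c → s ≤ L := by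
  classical
  let p : ℕ → Prop := fun L => L = 0 ∨ ∃ x, (L, x) ∈ ν
  refine ⟨Nat.findGreatest p (c - 1), ?_, ?_, ?_⟩
  · have := Nat.findGreatest_le (P := p) (c - 1)
    omega
  · exact Nat.findGreatest_spec (P := p) (Nat.zero_le _) (Or.inl rfl)
  · intro s y hs hsc
    exact Nat.le_findGreatest (by omega) (Or.inr ⟨y, hs⟩)

namespace Cascade

variable {a m i c : ℕ} {R : RC} {C : ℕ → Finset ℕ} {e : ℕ → ℕ}

lemma cap_le (h : Cascade a m i c R C e) (him : i ≤ m) : ∀ t ∈ C i, t ≤ e i := by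
  rcases him.lt_or_eq with hlt | rfl
  · simp [h.capEmpty i hlt]
  · exact h.capLe le_rfl

lemma selects (h : Cascade a m i c R C e) (hi : 1 ≤ i) (hai : a ≤ i) (him : i ≤ m) :
    ∃ L, Selects (R i) L (-((C i).card : ℤ)) ∧ L < c ∧ e i ≤ L ∧
      ∀ s y, (s, y) ∈ R i → s < c → s ≤ L := by
  have hec := h.next him
  obtain ⟨L, hLc, hL, hmax⟩ := exists_longest_lt (R i) c (by omega)
  have heL : e i ≤ L := by
    rcases h.str i hai him with h0 | ⟨x, hx⟩
    · omega
    · exact hmax _ _ hx hec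
  have hCL : ∀ s, e i ≤ s → (C i).filter (· ≤ s) = C i := fun s hs =>
    Finset.filter_true_of_mem fun t ht => (h.cap_le him t ht).trans hs
  have hrig : ∀ s x, (s, x) ∈ R i →
      x = -(((C i).filter (· ≤ s)).card : ℤ) + if c ≤ s then 1 else 0 := by
    intro s x hs
    have := h.rig i s x hs
    rw [cappedRig, h.capEmpty (i - 1) (by omega)] at this
    simpa using this
  refine ⟨L, ?_, hLc, heL, hmax⟩
  by_cases hex : ∃ x, (L, x) ∈ R i
  · left
    obtain ⟨x, hx⟩ := hex
    have hxe := hrig L x hx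
    rw [hCL L heL, if_neg (by omega), add_zero] at hxe
    subst hxe
    refine ⟨hx, by simp, fun s y hs => ?_⟩
    have hy := hrig s y hs
    have hcard := Finset.card_filter_le (C i) (· ≤ s)
    by_cases hcs : c ≤ s
    · rw [hCL s (by omega), if_pos hcs] at hy
      omega
    · rw [if_neg hcs] at hy
      exact ⟨by omega, fun _ => hmax _ _ hs (by omega)⟩
  · right
    have hL0 : L = 0 := hL.resolve_right hex
    have hC : C i = ∅ := by
      rw [Finset.eq_empty_iff_forall_notMem]
      intro t ht
      have := h.capPos i t ht
      have := h.cap_le him t ht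
      omega
    refine ⟨hL0, by simp [hC], fun s y hs => ?_⟩
    have hy := hrig s y hs
    have hp := h.pos i s y hs
    have hcs : c ≤ s := by
      by_contra hcs
      have := hmax s y hs (by omega)
      omega
    rw [hC, if_pos hcs] at hy
    simp at hy
    omega

/-- Applying the next operator of a lower subinterval. -/
lemma step (h : Cascade a m i c R C e) (hi : 1 ≤ i) (hai : a ≤ i) (him : i ≤ m) :
    Cascade a m (i + 1) (selCol i R) (fOp i R) C (Function.update e i (selCol i R)) := by
  obtain ⟨L, hsel, hLc, heL, hmax⟩ := h.selects hi hai him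
  rw [hsel.selCol_eq]
  obtain ⟨k, rfl⟩ : ∃ k, i = k + 1 := ⟨i - 1, by omega⟩
  have hkm : k < m := by omega
  have hgap : ∀ s y, (s, y) ∈ R (k + 1) → L + 1 ≤ s → c ≤ s := by
    intro s y hs hLs
    by_contra hcs
    have := hmax s y hs (by omega)
    omega
  have hconst : colHt (R (k + 1)) (L + 1) ≤ colHt (R (k + 1)) c := colHt_le_of_forall hgap
  have hge := h.ge k hkm c (by omega)
  have hle := h.le k hkm (L + 1) (by omega)
  simp only [true_and, if_true] at hge hle
  have hanti1 := colHt_anti (R k) (show L + 1 ≤ c by omega)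
  have hanti2 := colHt_anti (R (k + 1)) (show L + 1 ≤ c by omega)
  have hconst' : colHt (R k) (L + 1) ≤ colHt (R k) c := by
    by_cases hc : L + 1 = c
    · rw [hc]
    · rw [if_neg hc] at hle
      omega
  have hgap' : ∀ s y, (s, y) ∈ R k → L + 1 ≤ s → c ≤ s := fun s y hs hLs =>
    le_of_colHt_le (by omega) hconst' hs hLs
  have hfilter : (C (k + 1)).filter (· ≤ L + 1) = C (k + 1) :=
    Finset.filter_true_of_mem fun t ht => by
      have := h.cap_le him t ht
      omega
  refine ⟨?_, ?_, ?_, h.capEmpty, h.capPos, ?_, ?_, ?_, ?_, ?_, ?_, ?_, ?_⟩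
  · rw [hsel.fOp_eq]
    simp [h.zero]
  · intro j s x hs
    rcases hsel.of_mem_fOp hs with ⟨-, rfl, -⟩ | ⟨z, hz, -⟩
    · omega
    · exact h.pos j s z hz
  · intro j s x hs
    rcases hsel.of_mem_fOp hs with ⟨rfl, rfl, rfl⟩ | ⟨z, hz, rfl⟩
    · rw [cappedRig, hfilter, h.capEmpty (k + 1 - 1) (by omega)]
      simp
    · rw [h.rig j s z hz]
      have h1 := hgap s z
      have h2 := hgap' s z
      unfold cartanA
      by_cases hj : j = k + 1
      · subst hj
        replace h1 := h1 hz
        simp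
        split_ifs <;> omega
      · by_cases hj' : j = k
        · subst hj'
          replace h2 := h2 hz
          simp
          split_ifs <;> omega
        · split_ifs <;> omega
  · intro j hj t ht
    have := h.le j hj t ht
    rw [hsel.colHt_fOp j ht, hsel.colHt_fOp (j + 1) ht]
    by_cases hjk : j = k
    · subst hjk
      by_cases htc : t = c
      · subst htc
        split_ifs <;> grind
      · split_ifs <;> grind
    · split_ifs <;> grind
  · intro j hj t ht
    have := h.ge j hj t ht
    rw [hsel.colHt_fOp j ht, hsel.colHt_fOp (j + 1) ht]
    by_cases hjk : j = k
    · subst hjk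
      by_cases htc : t = L + 1
      · subst htc
        split_ifs <;> grind
      · split_ifs <;> grind
    · split_ifs <;> grind
  · intro j haj hjm
    by_cases hj : j = k + 1
    · subst hj
      rw [Function.update_self]
      exact Or.inr ⟨_, hsel.mem_fOp_self⟩
    · rw [Function.update_of_ne hj]
      exact (h.str j haj hjm).imp id fun hx => hsel.exists_mem_fOp_of_ne hj hx
  · intro j haj hjm hj
    have hjk : j ≠ k + 1 := by omega
    rw [Function.update_of_ne hjk]
    by_cases hj' : j = k
    · subst hj'
      rw [Function.update_self, h.front j haj rfl]
      omega
    · rw [Function.update_of_ne (by omega)]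
      exact h.anti j haj hjm (by omega)
  · intro j _ hj
    obtain rfl : j = k + 1 := by omega
    rw [Function.update_self]
  · intro hlt
    rw [Function.update_of_ne (by omega)]
    have := h.anti (k + 1) hai (by omega) (by omega)
    omega
  · intro hlt
    rw [Function.update_of_ne (by omega)]
    exact h.capLe (by omega)
  · intro hlt t ht
    obtain rfl : m = k + 1 := by omega
    have := h.cap_le le_rfl t ht
    omega

end Cascade

/-- The state in which a lower subinterval `(a, …, m)` may be applied. -/
structure Ready (a m : ℕ) (R : RC) (C : ℕ → Finset ℕ) (e : ℕ → ℕ) : Prop where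
  zero : R 0 = 0
  pos : ∀ j s x, (s, x) ∈ R j → 1 ≤ s
  rig : ∀ j s x, (s, x) ∈ R j → x = cappedRig C j s
  capEmpty : ∀ j < m, C j = ∅
  capPos : ∀ j, ∀ t ∈ C j, 1 ≤ t
  le : ∀ j < m, ∀ t, 1 ≤ t → colHt (R j) t ≤ colHt (R (j + 1)) t
  ge : ∀ j < m, ∀ t, 1 ≤ t → colHt (R (j + 1)) t ≤ colHt (R j) t + 1
  str : ∀ j, a ≤ j → j ≤ m → e j = 0 ∨ ∃ x, (e j, x) ∈ R j
  anti : ∀ j, a ≤ j → j < m → e (j + 1) ≤ e j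
  capLe : ∀ t ∈ C m, t ≤ e m

namespace Ready

variable {a m : ℕ} {R : RC} {C : ℕ → Finset ℕ} {e : ℕ → ℕ}

lemma empty (a m : ℕ) : Ready a m emptyRC (fun _ => ∅) (fun _ => 0) := by
  constructor <;> simp [emptyRC, colHt]

/-- Passing to a later starting point or to a lower component. -/
lemma mono (h : Ready a m R C e) {b k : ℕ} (hch : CascCh (a, m) (b, k)) :
    ∃ e', Ready b k R C e' := by
  rcases hch with hlt | ⟨rfl, hab⟩
  · replace hlt : k < m := hlt
    exact ⟨fun _ => 0, h.zero, h.pos, h.rig, fun j hj => h.capEmpty j (hj.trans hlt), h.capPos,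
      fun j hj => h.le j (hj.trans hlt), fun j hj => h.ge j (hj.trans hlt),
      fun _ _ _ => Or.inl rfl, fun _ _ _ => le_rfl, by simp [h.capEmpty k hlt]⟩
  · replace hab : a ≤ b := hab
    exact ⟨e, h.zero, h.pos, h.rig, h.capEmpty, h.capPos, h.le, h.ge,
      fun j hj => h.str j (hab.trans hj), fun j hj => h.anti j (hab.trans hj), h.capLe⟩

lemma cascade (h : Ready a m R C e) (ham : a ≤ m) : ∃ c, Cascade a m a c R C e := by
  let len : ℕ → ℕ := fun j => ((R j).map Prod.fst).sup
  have hlen : ∀ j s x, (s, x) ∈ R j → s ≤ len j := fun j s x hs =>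
    Multiset.le_sup (Multiset.mem_map.2 ⟨(s, x), hs, rfl⟩)
  refine ⟨len a + len (a - 1) + e a + 1, h.zero, h.pos, ?_, h.capEmpty, h.capPos,
    fun j hj t ht => (h.le j hj t ht).trans (Nat.le_add_right _ _), ?_, h.str,
    fun j hj hjm _ => h.anti j hj hjm, fun j hj hja => by omega, fun _ => by omega,
    fun _ => h.capLe, fun hlt => by omega⟩
  · intro j s x hs
    have h1 := hlen j s x hs
    rw [if_neg, if_neg, add_zero, sub_zero]
    · exact h.rig j s x hs
    · rintro ⟨rfl, hc⟩
      simp only [Nat.add_sub_cancel] at hc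
      omega
    · rintro ⟨rfl, hc⟩
      omega
  · intro j hj t ht
    split_ifs with hcond
    · obtain ⟨rfl, rfl⟩ := hcond
      have h0 : colHt (R (j + 1)) (len (j + 1) + len (j + 1 - 1) + e (j + 1) + 1) = 0 := by
        rw [colHt, Multiset.card_eq_zero, Multiset.filter_eq_nil]
        rintro ⟨s, x⟩ hs hle
        have := hlen (j + 1) s x hs
        simp only at hle
        omega
      omega
    · exact h.ge j hj t ht

end Ready

lemma Cascade.ready {a m c : ℕ} {R : RC} {C : ℕ → Finset ℕ} {e : ℕ → ℕ}
    (h : Cascade a m (m + 1) c R C e) (ham : a ≤ m) (hc : 1 ≤ c) :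
    Ready a m R (Function.update C m (insert c (C m))) e := by
  have hlt := h.capLt (Nat.lt_succ_self m)
  have hnot : c ∉ C m := fun hmem => lt_irrefl _ (hlt c hmem)
  have hcard : ∀ s, (((insert c (C m)).filter (· ≤ s)).card : ℤ)
      = (((C m).filter (· ≤ s)).card : ℤ) + if c ≤ s then 1 else 0 := by
    intro s
    rw [Finset.filter_insert]
    split_ifs with hcs
    · rw [Finset.card_insert_of_notMem (by simp [hnot])]
      simp
    · simp
  refine ⟨h.zero, h.pos, ?_, ?_, ?_, ?_, ?_, h.str, fun j hj hjm => h.anti j hj hjm (by omega), ?_⟩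
  · intro j s x hs
    have hx := h.rig j s x hs
    have hj0 : j ≠ 0 := by
      rintro rfl
      simp [h.zero] at hs
    rw [hx, cappedRig, cappedRig]
    by_cases hjm : j = m
    · subst hjm
      rw [Function.update_self, Function.update_of_ne (by omega), hcard]
      split_ifs <;> omega
    · rw [Function.update_of_ne hjm]
      by_cases hjm' : j = m + 1
      · subst hjm'
        rw [Nat.add_sub_cancel, Function.update_self, hcard]
        split_ifs <;> omega
      · rw [Function.update_of_ne (by omega)]
        split_ifs <;> omega
  · intro j hj
    rw [Function.update_of_ne (by omega)]
    exact h.capEmpty j hj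
  · intro j t ht
    by_cases hj : j = m
    · subst hj
      rw [Function.update_self, Finset.mem_insert] at ht
      rcases ht with rfl | ht
      · exact hc
      · exact h.capPos j t ht
    · rw [Function.update_of_ne hj] at ht
      exact h.capPos j t ht
  · intro j hj t ht
    have := h.le j hj t ht
    rwa [if_neg (by omega), add_zero] at this
  · intro j hj t ht
    have := h.ge j hj t ht
    rwa [if_neg (by omega), add_zero] at this
  · intro t ht
    rw [Function.update_self, Finset.mem_insert] at ht
    rw [h.front m ham rfl]
    rcases ht with rfl | ht
    · exact le_rfl
    · exact (hlt t ht).le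

lemma fList_append (γ δ : List ℕ) (R : RC) : fList (γ ++ δ) R = fList δ (fList γ R) :=
  List.foldl_append

lemma Ready.exists_cascade {a m : ℕ} {R : RC} {C : ℕ → Finset ℕ} {e : ℕ → ℕ}
    (h : Ready a m R C e) (ha : 1 ≤ a) (k : ℕ) (hk : a + k ≤ m) :
    ∃ c e', Cascade a m (a + k) c (fList (List.range' a k) R) C e' := by
  induction k with
  | zero =>
    obtain ⟨c, hc⟩ := h.cascade hk
    exact ⟨c, e, hc⟩
  | succ k ih =>
    obtain ⟨c, e', hc⟩ := ih (by omega)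
    rw [List.range'_1_concat, fList_append]
    exact ⟨_, _, hc.step (by omega) (by omega) (by omega)⟩

lemma one_le_selCol (a : ℕ) (R : RC) : 1 ≤ selCol a R := by
  unfold selCol
  split_ifs <;> omega

/-- Applying a whole lower subinterval caps one further column. -/
lemma Ready.apply {a m : ℕ} {R : RC} {C : ℕ → Finset ℕ} {e : ℕ → ℕ}
    (h : Ready a m R C e) (ha : 1 ≤ a) (ham : a ≤ m) :
    ∃ e', Ready a m (fList (lowerInt a m) R)
      (Function.update C m (insert (ivCol (a, m) m R) (C m))) e' := by
  obtain ⟨c, e', hc⟩ := h.exists_cascade ha (m - a) (by omega)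
  rw [show a + (m - a) = m by omega] at hc
  have h1 : lowerInt a m = List.range' a (m - a) ++ [m] := by
    rw [lowerInt, show m + 1 - a = m - a + 1 by omega, List.range'_1_concat,
      show a + (m - a) = m by omega]
  have h2 : lowerInt a (m - 1) = List.range' a (m - a) := by
    rw [lowerInt, show m - 1 + 1 - a = m - a by omega]
  rw [h1, fList_append, ivCol, h2]
  exact ⟨_, (hc.step (by omega) ham le_rfl).ready ham (one_le_selCol _ _)⟩

lemma capped_concat (ivs : List (ℕ × ℕ)) (p : ℕ × ℕ) (l i : ℕ) :
    Capped (ivs ++ [p]) l i ↔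
      Capped ivs l i ∨ (p.2 = l ∧ ivCol p l (RCseq (seqOf ivs)) = i) := by
  constructor
  · rintro ⟨k, hk, h⟩
    rw [List.length_append, List.length_singleton] at hk
    by_cases hlt : k < ivs.length
    · left
      refine ⟨k, hlt, ?_⟩
      rwa [List.getElem_append_left hlt, Rk, List.take_append_of_le_length hlt.le] at h
    · right
      obtain rfl : k = ivs.length := by omega
      simpa [Rk] using h
  · rintro (⟨k, hk, h⟩ | h)
    · refine ⟨k, by simp; omega, ?_⟩
      rwa [List.getElem_append_left hk, Rk, List.take_append_of_le_length hk.le]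
    · exact ⟨ivs.length, by simp, by simpa [Rk] using h⟩

lemma RCseq_concat (ivs : List (ℕ × ℕ)) (p : ℕ × ℕ) :
    RCseq (seqOf (ivs ++ [p])) = fList (lowerInt p.1 p.2) (RCseq (seqOf ivs)) := by
  simp [RCseq, seqOf, fList_append]

/-- A cascading sequence leads to a state in which every admissible lower subinterval may
be applied. -/
lemma exists_ready (n : ℕ) (ivs : List (ℕ × ℕ)) (hc : IsCascDecomp n ivs) :
    ∃ C : ℕ → Finset ℕ, (∀ l i, i ∈ C l ↔ Capped ivs l i) ∧
      ∀ a m, (∀ p ∈ ivs.getLast?, CascCh p (a, m)) →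
        ∃ e, Ready a m (RCseq (seqOf ivs)) C e := by
  induction ivs using List.reverseRecOn with
  | nil =>
    refine ⟨fun _ => ∅, fun l i => ?_, fun a m _ => ⟨_, Ready.empty a m⟩⟩
    simp [Capped]
  | append_singleton ivs p ih =>
    obtain ⟨hiv, hch⟩ := hc
    have hch' := List.isChain_append.1 hch
    obtain ⟨C, hC, hready⟩ := ih ⟨fun q hq => hiv q (by simp [hq]), hch'.1⟩
    obtain ⟨hp1, hp2, -⟩ := hiv p (by simp)
    obtain ⟨e, he⟩ := hready p.1 p.2 fun q hq => hch'.2.2 q hq p (by simp)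
    obtain ⟨e', he'⟩ := he.apply hp1 hp2
    refine ⟨Function.update C p.2 (insert (ivCol p p.2 (RCseq (seqOf ivs))) (C p.2)),
      fun l i => ?_, fun a m h => ?_⟩
    · rw [capped_concat, ← hC]
      by_cases hl : l = p.2
      · subst hl
        rw [Function.update_self, Finset.mem_insert]
        simp only [true_and]
        grind
      · rw [Function.update_of_ne hl]
        grind
    · rw [RCseq_concat]
      exact he'.mono (h p (by simp))

/-- Lemma "lane rig".
The rigging of a string of length `s` of `ν_l` equals minus the number of capped
column indices `i ≤ s` for the `l`-th partition plus the number of capped column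
indices `i ≤ s` for the `(l-1)`-st partition (the latter count being 0 for `l = 1`,
as no lower subinterval has maximum `0`). -/
theorem rigging_from_capped_columns (n : ℕ) (hn : 0 < n)
    (ivs : List (ℕ × ℕ)) (hc : IsCascDecomp n ivs)
    (l : ℕ) (hl : 1 ≤ l) (hln : l ≤ n)
    (s : ℕ) (x : ℤ) (hs : (s, x) ∈ RCseq (seqOf ivs) l) :
    x = -({i : ℕ | 1 ≤ i ∧ i ≤ s ∧ Capped ivs l i}.ncard : ℤ)
        + ({i : ℕ | 1 ≤ i ∧ i ≤ s ∧ Capped ivs (l - 1) i}.ncard : ℤ) := by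
  obtain ⟨C, hC, hready⟩ := exists_ready n ivs hc
  obtain ⟨e, he⟩ := hready 1 0 fun p hp => by
    obtain ⟨h1, h2, -⟩ := hc.1 p (List.mem_of_mem_getLast? hp)
    exact Or.inl (lt_of_lt_of_le Nat.zero_lt_one (h1.trans h2))
  have hset : ∀ j, {i : ℕ | 1 ≤ i ∧ i ≤ s ∧ Capped ivs j i} = ↑((C j).filter (· ≤ s)) := by
    intro j
    ext i
    simp only [Set.mem_ofPred_eq, Finset.coe_filter, ← hC]
    exact ⟨fun h => ⟨h.2.2, h.2.1⟩, fun h => ⟨he.capPos j i h.1, h.2, h.1⟩⟩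
  rw [hset, hset, Set.ncard_coe_finset, Set.ncard_coe_finset]
  exact he.rig l s x hs

end CascRC
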